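/- Let 0<q<1, a,b ∈ ℝ, and m ∈ ℕ ∪ {0}. Then for every real x, the derivative of the function x \mapsto R(a,b,q,q^m x) at x equals a·q^m·R(a,b,q,q^m x) + b·q^m·R(a,b,q,q^{m+1} x). -/

import Mathlib

open Finset

/-- The Ramanujan function `R(a,b,q,x) = 1 + ∑_{n≥1} (xⁿ/n!) ∏_{j=0}^{n-1} (a + b qʲ)`,
written as a single `tsum` (the `n = 0` term equals `1`). -/
noncomputable def ramanujanR (a b q x : ℝ) : ℝ :=
  ∑' n : ℕ, x ^ n / (Nat.factorial n : ℝ) * ∏ j ∈ Finset.range n, (a + b * q ^ j)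

theorem abs_prod_add_mul_pow_le {q : ℝ} (hq0 : 0 < q) (hq1 : q < 1) (a b : ℝ) (n : ℕ) :
    |∏ j ∈ Finset.range n, (a + b * q ^ j)| ≤ (|a| + |b|) ^ n := by
  rw [Finset.abs_prod]
  calc ∏ j ∈ Finset.range n, |a + b * q ^ j|
      ≤ ∏ _j ∈ Finset.range n, (|a| + |b|) := by
        refine Finset.prod_le_prod (fun j _ => abs_nonneg _) fun j _ => ?_
        refine (abs_add_le _ _).trans ?_
        rw [abs_mul, abs_of_nonneg (pow_nonneg hq0.le j)]
        gcongr
        exact mul_le_of_le_one_right (abs_nonneg b) (pow_le_one₀ hq0.le hq1.le)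
    _ = (|a| + |b|) ^ n := by simp

theorem summable_ramanujanR {q : ℝ} (hq0 : 0 < q) (hq1 : q < 1) (a b x : ℝ) :
    Summable fun n : ℕ =>
      x ^ n / (Nat.factorial n : ℝ) * ∏ j ∈ Finset.range n, (a + b * q ^ j) := by
  refine Summable.of_norm_bounded (Real.summable_pow_div_factorial (|x| * (|a| + |b|)))
    fun n => ?_
  rw [Real.norm_eq_abs, abs_mul, abs_div, abs_pow, Nat.abs_cast, mul_pow, mul_div_right_comm]
  gcongr
  exact abs_prod_add_mul_pow_le hq0 hq1 a b n

theorem cast_succ_mul_pow_div_factorial_succ (n : ℕ) (x : ℝ) :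
    ((n + 1 : ℕ) : ℝ) * x ^ n / (Nat.factorial (n + 1) : ℝ) = x ^ n / (Nat.factorial n : ℝ) := by
  rw [Nat.factorial_succ, Nat.cast_mul]
  exact mul_div_mul_left _ _ (Nat.cast_ne_zero.mpr n.succ_ne_zero)

theorem hasDerivAt_ramanujanR {q : ℝ} (hq0 : 0 < q) (hq1 : q < 1) (a b x : ℝ) :
    HasDerivAt (ramanujanR a b q) (a * ramanujanR a b q x + b * ramanujanR a b q (q * x)) x := by
  set P : ℕ → ℝ := fun n => ∏ j ∈ Finset.range n, (a + b * q ^ j) with hP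
  set r : ℝ := |x| + 1
  set K : ℝ := |a| + |b|
  have hu : Summable fun n : ℕ => (n : ℝ) * r ^ (n - 1) / (Nat.factorial n : ℝ) * K ^ n := by
    rw [← summable_nat_add_iff 1]
    refine ((Real.summable_pow_div_factorial (r * K)).mul_right K).congr fun n => ?_
    rw [Nat.add_sub_cancel, cast_succ_mul_pow_div_factorial_succ, mul_pow, pow_succ]
    ring
  have hbound : ∀ (n : ℕ) (y : ℝ), y ∈ Metric.ball (0 : ℝ) r →
      ‖(n : ℝ) * y ^ (n - 1) / (Nat.factorial n : ℝ) * P n‖ ≤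
        (n : ℝ) * r ^ (n - 1) / (Nat.factorial n : ℝ) * K ^ n := by
    intro n y hy
    rw [mem_ball_zero_iff, Real.norm_eq_abs] at hy
    rw [Real.norm_eq_abs, abs_mul, abs_div, abs_mul, abs_pow, Nat.abs_cast, Nat.abs_cast]
    gcongr
    exact abs_prod_add_mul_pow_le hq0 hq1 a b n
  have hx : x ∈ Metric.ball (0 : ℝ) r := by
    rw [mem_ball_zero_iff, Real.norm_eq_abs]
    exact lt_add_one _
  have hderiv := hasDerivAt_tsum_of_isPreconnected hu Metric.isOpen_ball
    (convex_ball (0 : ℝ) r).isPreconnected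
    (fun n y _ => ((hasDerivAt_pow n y).div_const (Nat.factorial n : ℝ)).mul_const (P n))
    hbound hx (summable_ramanujanR hq0 hq1 a b x) hx
  have hsum : ∑' n : ℕ, (n : ℝ) * x ^ (n - 1) / (Nat.factorial n : ℝ) * P n =
      a * ramanujanR a b q x + b * ramanujanR a b q (q * x) := by
    rw [(Summable.of_norm_bounded hu fun n => hbound n x hx).tsum_eq_zero_add]
    unfold ramanujanR
    rw [← tsum_mul_left, ← tsum_mul_left,
      ← ((summable_ramanujanR hq0 hq1 a b x).mul_left a).tsum_add
        ((summable_ramanujanR hq0 hq1 a b (q * x)).mul_left b)]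
    simp only [Nat.cast_zero, zero_mul, zero_div, zero_add]
    refine tsum_congr fun n => ?_
    rw [Nat.add_sub_cancel, cast_succ_mul_pow_div_factorial_succ, hP]
    simp only [Finset.prod_range_succ]
    ring
  rw [← hsum]
  exact hderiv

/-- For `m ∈ ℕ ∪ {0}`, `d/dx R(a,b,q,qᵐx) = a qᵐ R(a,b,q,qᵐx) + b qᵐ R(a,b,q,q^{m+1}x)`. -/
theorem stmt_3 (q a b : ℝ) (hq0 : 0 < q) (hq1 : q < 1) (m : ℕ) :
    ∀ x : ℝ, HasDerivAt (fun t => ramanujanR a b q (q ^ m * t))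
      (a * q ^ m * ramanujanR a b q (q ^ m * x) +
        b * q ^ m * ramanujanR a b q (q ^ (m + 1) * x)) x := by
  intro x
  have h := (hasDerivAt_ramanujanR hq0 hq1 a b (q ^ m * x)).comp x
    ((hasDerivAt_id x).const_mul (q ^ m))
  refine h.congr_deriv ?_
  rw [pow_succ', mul_assoc q, mul_one]
  ring
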